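/- In any crowdfunding game with parameters (n, μ, p, T, τ) whose price is moderate (β_l < τ < β_h), there exists a unique symmetric non-trivial Bayes–Nash equilibrium σ*, and this equilibrium satisfies σ*(h) = 1 and σ*(l) = λ for some λ ∈ [0,1): agents with high signals contribute with probability one, and agents with low signals mix with a probability strictly below one. -/

import Mathlib

open Finset Filter

/-- Upper tail of the binomial distribution: `P(Bin(m, r) ≥ k)`. -/
noncomputable def binTail (m k : ℕ) (r : ℝ) : ℝ :=
  ∑ j ∈ Finset.Icc k m, (m.choose j : ℝ) * r ^ j * (1 - r) ^ (m - j)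

/-- Contribution probability conditional on the high-value state `G`. -/
noncomputable def rG (p σh σl : ℝ) : ℝ := p * σh + (1 - p) * σl

/-- Contribution probability conditional on the low-value state `B`. -/
noncomputable def rB (p σh σl : ℝ) : ℝ := (1 - p) * σh + p * σl

/-- Posterior probability of state `G` after the high signal `h`. -/
noncomputable def postH (μ p : ℝ) : ℝ := μ * p / (μ * p + (1 - μ) * (1 - p))

/-- Posterior probability of state `G` after the low signal `l`. -/
noncomputable def postL (μ p : ℝ) : ℝ := μ * (1 - p) / (μ * (1 - p) + (1 - μ) * p)

/-- Expected gain from contributing for an agent whose posterior on `G` is `β`,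
when each of the other `n - 1` agents plays the symmetric strategy `(σh, σl)`
and the threshold is `T`. -/
noncomputable def gain (n T : ℕ) (p τ β σh σl : ℝ) : ℝ :=
  β * (1 - τ) * binTail (n - 1) (T - 1) (rG p σh σl)
    - (1 - β) * τ * binTail (n - 1) (T - 1) (rB p σh σl)

/-- `(σh, σl)` is a symmetric Bayes–Nash equilibrium of the crowdfunding game
with parameters `(n, μ, p, T, τ)`. -/
def IsSymmEq (n T : ℕ) (μ p τ σh σl : ℝ) : Prop :=
  0 ≤ σh ∧ σh ≤ 1 ∧ 0 ≤ σl ∧ σl ≤ 1 ∧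
  (0 < σh → 0 ≤ gain n T p τ (postH μ p) σh σl) ∧
  (σh < 1 → gain n T p τ (postH μ p) σh σl ≤ 0) ∧
  (0 < σl → 0 ≤ gain n T p τ (postL μ p) σh σl) ∧
  (σl < 1 → gain n T p τ (postL μ p) σh σl ≤ 0)

/-- The upper tail with threshold `0` is the total mass. -/
theorem binTail_zero (m : ℕ) (r : ℝ) : binTail m 0 r = 1 := by
  have h := add_pow r (1 - r) m
  rw [add_sub_cancel, one_pow] at h
  rw [h, binTail, Finset.range_eq_Ico, Finset.Ico_add_one_right_eq_Icc]
  exact Finset.sum_congr rfl fun j _ ↦ by ring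

theorem binTail_pos {m k : ℕ} (hk : k ≤ m) {r : ℝ} (hr : 0 < r) (hr1 : r ≤ 1) :
    0 < binTail m k r := by
  have h1 : 0 ≤ 1 - r := sub_nonneg.2 hr1
  refine Finset.sum_pos' (fun j _ ↦ by positivity)
    ⟨m, Finset.mem_Icc.2 ⟨hk, le_rfl⟩, ?_⟩
  simpa using pow_pos hr m

theorem continuous_binTail (m k : ℕ) : Continuous (binTail m k) := by
  unfold binTail
  fun_prop

theorem binTail_eq_eval_bernstein (m k : ℕ) (r : ℝ) :
    binTail m k r = (∑ j ∈ Finset.Icc k m, bernsteinPolynomial ℝ m j).eval r := by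
  simp [binTail, bernsteinPolynomial, Polynomial.eval_finsetSum]

/-- The derivative of the binomial tail is a single Beta density term. -/
theorem hasDerivAt_binTail {m k : ℕ} (hk : k ≤ m) (r : ℝ) :
    HasDerivAt (binTail (m + 1) (k + 1))
      ((m + 1) * (m.choose k * r ^ k * (1 - r) ^ (m - k))) r := by
  have h : Polynomial.derivative (∑ j ∈ Finset.Icc (k + 1) (m + 1), bernsteinPolynomial ℝ (m + 1) j)
      = (m + 1) * bernsteinPolynomial ℝ m k := by
    rw [Polynomial.derivative_sum, ← Finset.Ico_add_one_right_eq_Icc, ← Finset.sum_Ico_add']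
    simp only [bernsteinPolynomial.derivative_succ_aux]
    rw [← Finset.mul_sum, Finset.sum_Ico_eq_sum_range]
    have := Finset.sum_range_sub' (fun i ↦ bernsteinPolynomial ℝ m (k + i)) (m + 1 - k)
    simp only [add_assoc] at this ⊢
    rw [this, add_zero, show k + (m + 1 - k) = m + 1 by omega,
      bernsteinPolynomial.eq_zero_of_lt ℝ (Nat.lt_succ_self m), sub_zero]
  have h2 := (∑ j ∈ Finset.Icc (k + 1) (m + 1), bernsteinPolynomial ℝ (m + 1) j).hasDerivAt r
  rw [h] at h2
  rw [funext (binTail_eq_eval_bernstein (m + 1) (k + 1))]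
  exact h2.congr_deriv (by simp [bernsteinPolynomial])

theorem monotoneOn_binTail {m k : ℕ} (hk : k ≤ m) :
    MonotoneOn (binTail m k) (Set.Icc 0 1) := by
  rcases k with _ | k
  · intro x _ y _ _
    simp [binTail_zero]
  obtain ⟨m, rfl⟩ : ∃ m', m = m' + 1 := ⟨m - 1, by omega⟩
  replace hk : k ≤ m := by omega
  refine monotoneOn_of_deriv_nonneg (convex_Icc 0 1) (continuous_binTail _ _).continuousOn
    (fun r _ ↦ (hasDerivAt_binTail hk r).differentiableAt.differentiableWithinAt) fun r hr ↦ ?_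
  rw [interior_Icc, Set.mem_Ioo] at hr
  have := hr.1
  have := sub_pos.2 hr.2
  rw [(hasDerivAt_binTail hk r).deriv]
  positivity

/-- The function `(1 - r) F'(r) / F(r)`, where `F` is the binomial tail, is strictly decreasing
(in cross-multiplied form). -/
theorem binTail_hazard_lt {m k : ℕ} (hk : k ≤ m) {r s : ℝ} (hs : 0 < s) (hsr : s < r)
    (hr : r < 1) :
    (1 - r) * (r ^ k * (1 - r) ^ (m - k)) * binTail (m + 1) (k + 1) s
      < (1 - s) * (s ^ k * (1 - s) ^ (m - k)) * binTail (m + 1) (k + 1) r := by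
  have hr0 : 0 < r := hs.trans hsr
  have hr1 : 0 < 1 - r := sub_pos.2 hr
  have hs1 : 0 < 1 - s := by linarith
  rw [binTail, binTail, Finset.mul_sum, Finset.mul_sum]
  refine Finset.sum_lt_sum_of_nonempty (Finset.nonempty_Icc.2 (by omega)) fun j hj ↦ ?_
  rw [Finset.mem_Icc] at hj
  obtain ⟨i, rfl⟩ := Nat.exists_eq_add_of_le hj.1
  obtain ⟨d, rfl⟩ : ∃ d, m = k + i + d := ⟨m - k - i, by omega⟩
  rw [show k + i + d - k = i + d by omega, show k + i + d + 1 - (k + 1 + i) = d by omega]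
  have hc : (0 : ℝ) < ((k + i + d + 1).choose (k + 1 + i) : ℝ) := by
    exact_mod_cast Nat.choose_pos (by omega)
  have key : ((1 - r) * s) ^ (i + 1) < ((1 - s) * r) ^ (i + 1) :=
    pow_lt_pow_left₀ (by nlinarith) (by positivity) (by omega)
  have h := mul_lt_mul_of_pos_left key
    (show 0 < ((k + i + d + 1).choose (k + 1 + i) : ℝ) * (r * s) ^ k * ((1 - r) * (1 - s)) ^ d by
      positivity)
  calc _ = _ := by simp only [mul_pow, pow_add]; ring
    _ < _ := h
    _ = _ := by simp only [mul_pow, pow_add]; ring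

/-- For `a < b`, the ratio `F(1 - a y) / F(1 - b y)` of binomial tails is strictly increasing
in `y`. -/
theorem strictMonoOn_binTail_ratio {m k : ℕ} (hk : k ≤ m) {a b : ℝ} (ha : 0 < a) (hab : a < b)
    (hb : b < 1) :
    StrictMonoOn
      (fun y ↦ binTail (m + 1) (k + 1) (1 - a * y) / binTail (m + 1) (k + 1) (1 - b * y))
      (Set.Icc 0 1) := by
  have hpos : ∀ c, 0 < c → c < 1 → ∀ y ∈ Set.Icc (0 : ℝ) 1,
      0 < binTail (m + 1) (k + 1) (1 - c * y) := fun c hc hc1 y hy ↦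
    binTail_pos (by omega) (by nlinarith [hy.1, hy.2]) (by nlinarith [hy.1])
  have hcont := continuous_binTail (m + 1) (k + 1)
  refine strictMonoOn_of_deriv_pos (convex_Icc 0 1) ?_ fun y hy ↦ ?_
  · exact ContinuousOn.div (by fun_prop) (by fun_prop)
      fun y hy ↦ (hpos b (ha.trans hab) hb y hy).ne'
  have hyI := interior_subset hy
  rw [interior_Icc, Set.mem_Ioo] at hy
  have hderiv : ∀ c : ℝ, HasDerivAt (fun y ↦ binTail (m + 1) (k + 1) (1 - c * y))
      ((m + 1) * (m.choose k * (1 - c * y) ^ k * (1 - (1 - c * y)) ^ (m - k)) * -c) y := by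
    intro c
    have hlin : HasDerivAt (fun y ↦ 1 - c * y) (-c) y := by
      simpa using ((hasDerivAt_id y).const_mul c).const_sub 1
    exact (hasDerivAt_binTail hk (1 - c * y)).comp y hlin
  have hB := hpos b (ha.trans hab) hb y hyI
  have h := (hderiv a).div (hderiv b) hB.ne'
  have hay : a * y < b * y := mul_lt_mul_of_pos_right hab hy.1
  have hby : b * y < 1 := by nlinarith [hy.1, hy.2]
  have key := binTail_hazard_lt hk (r := 1 - a * y) (s := 1 - b * y) (by linarith)
    (by linarith) (by nlinarith [mul_pos ha hy.1])
  have hc : (0 : ℝ) < (m + 1) * m.choose k := by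
    have : (0 : ℝ) < m.choose k := by exact_mod_cast Nat.choose_pos hk
    positivity
  refine lt_of_lt_of_eq (div_pos ?_ (pow_pos hB 2)) h.deriv.symm
  refine pos_of_mul_pos_left (b := y) ?_ hy.1.le
  simp only [sub_sub_cancel] at key ⊢
  have h3 := mul_lt_mul_of_pos_left key hc
  linear_combination h3

/-- Single crossing: with `σ(h) = 1`, the likelihood ratio of success in the two states strictly
decreases in the contribution probability after the low signal. -/
theorem binTail_single_crossing {m k : ℕ} (hk : k ≤ m) {p : ℝ} (hp : 1 / 2 < p) (hp1 : p < 1)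
    {x y : ℝ} (hx : 0 ≤ x) (hxy : x < y) (hy : y ≤ 1) :
    binTail (m + 1) (k + 1) (rG p 1 y) * binTail (m + 1) (k + 1) (rB p 1 x)
      < binTail (m + 1) (k + 1) (rG p 1 x) * binTail (m + 1) (k + 1) (rB p 1 y) := by
  have h := strictMonoOn_binTail_ratio hk (a := 1 - p) (b := p) (by linarith) (by linarith) hp1
    (show 1 - y ∈ Set.Icc (0 : ℝ) 1 from ⟨by linarith, by linarith⟩)
    (show 1 - x ∈ Set.Icc (0 : ℝ) 1 from ⟨by linarith, by linarith⟩) (by linarith)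
  have hG : ∀ z, 1 - (1 - p) * (1 - z) = rG p 1 z := fun z ↦ by rw [rG]; ring
  have hB : ∀ z, 1 - p * (1 - z) = rB p 1 z := fun z ↦ by rw [rB]; ring
  have hpos : ∀ z, 0 ≤ z → z ≤ 1 → 0 < binTail (m + 1) (k + 1) (rB p 1 z) := fun z hz hz1 ↦
    binTail_pos (by omega) (by rw [rB]; nlinarith) (by rw [rB]; nlinarith)
  simp only [hG, hB] at h
  rwa [div_lt_div_iff₀ (hpos y (by linarith) hy) (hpos x hx (by linarith))] at h

theorem postH_lt_one {μ p : ℝ} (hμ : 0 < μ ∧ μ < 1) (hp : 0 < p ∧ p < 1) : postH μ p < 1 := by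
  have h1 := mul_pos hμ.1 hp.1
  have h2 := mul_pos (sub_pos.2 hμ.2) (sub_pos.2 hp.2)
  rw [postH, div_lt_one (by linarith)]
  linarith

theorem postL_pos {μ p : ℝ} (hμ : 0 < μ ∧ μ < 1) (hp : 0 < p ∧ p < 1) : 0 < postL μ p := by
  have h1 := mul_pos hμ.1 (sub_pos.2 hp.2)
  have h2 := mul_pos (sub_pos.2 hμ.2) hp.1
  exact div_pos h1 (by linarith)

theorem rG_mem_Icc {p σh σl : ℝ} (hp : 0 < p ∧ p < 1) (hh : 0 ≤ σh ∧ σh ≤ 1)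
    (hl : 0 ≤ σl ∧ σl ≤ 1) : rG p σh σl ∈ Set.Icc (0 : ℝ) 1 := by
  constructor <;> rw [rG] <;> nlinarith

theorem rB_eq_rG (p σh σl : ℝ) : rB p σh σl = rG (1 - p) σh σl := by
  rw [rB, rG]
  ring

theorem rB_mem_Icc {p σh σl : ℝ} (hp : 0 < p ∧ p < 1) (hh : 0 ≤ σh ∧ σh ≤ 1)
    (hl : 0 ≤ σl ∧ σl ≤ 1) : rB p σh σl ∈ Set.Icc (0 : ℝ) 1 :=
  rB_eq_rG p σh σl ▸ rG_mem_Icc ⟨by linarith, by linarith⟩ hh hl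

/-- An agent whose posterior exceeds the price strictly gains from contributing when high-signal
agents contribute at least as often as low-signal ones. -/
theorem gain_pos {n T : ℕ} (hT : 1 ≤ T ∧ T ≤ n) {p τ β σh σl : ℝ} (hp : 1 / 2 < p ∧ p < 1)
    (hτ : 0 < τ) (hβ : τ < β) (hβ1 : β < 1) (hσ : 0 < σh) (hh : σh ≤ 1) (hl : 0 ≤ σl)
    (hlh : σl ≤ σh) : 0 < gain n T p τ β σh σl := by
  have hp' : 0 < p ∧ p < 1 := ⟨by linarith, hp.2⟩
  have hGm := rG_mem_Icc hp' ⟨hσ.le, hh⟩ ⟨hl, hlh.trans hh⟩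
  have hk : T - 1 ≤ n - 1 := by omega
  have hG : 0 < binTail (n - 1) (T - 1) (rG p σh σl) :=
    binTail_pos hk (by rw [rG]; nlinarith) hGm.2
  have hle : binTail (n - 1) (T - 1) (rB p σh σl) ≤ binTail (n - 1) (T - 1) (rG p σh σl) :=
    monotoneOn_binTail hk (rB_mem_Icc hp' ⟨hσ.le, hh⟩ ⟨hl, hlh.trans hh⟩) hGm
      (by rw [rB, rG]; nlinarith)
  have h1 := mul_le_mul_of_nonneg_left hle (mul_pos (sub_pos.2 hβ1) hτ).le
  have h2 := mul_pos (sub_pos.2 hβ) hG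
  rw [gain]
  linarith

/-- An agent whose posterior is below the price strictly loses from contributing when low-signal
agents contribute at least as often as high-signal ones. -/
theorem gain_neg {n T : ℕ} (hT : 1 ≤ T ∧ T ≤ n) {p τ β σh σl : ℝ} (hp : 1 / 2 < p ∧ p < 1)
    (hτ : τ < 1) (hβ0 : 0 < β) (hβ : β < τ) (hσ : 0 < σl) (hl : σl ≤ 1) (hh : 0 ≤ σh)
    (hhl : σh ≤ σl) : gain n T p τ β σh σl < 0 := by
  have hp' : 0 < p ∧ p < 1 := ⟨by linarith, hp.2⟩
  have hBm := rB_mem_Icc hp' ⟨hh, hhl.trans hl⟩ ⟨hσ.le, hl⟩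
  have hk : T - 1 ≤ n - 1 := by omega
  have hB : 0 < binTail (n - 1) (T - 1) (rB p σh σl) :=
    binTail_pos hk (by rw [rB]; nlinarith) hBm.2
  have hle : binTail (n - 1) (T - 1) (rG p σh σl) ≤ binTail (n - 1) (T - 1) (rB p σh σl) :=
    monotoneOn_binTail hk (rG_mem_Icc hp' ⟨hh, hhl.trans hl⟩ ⟨hσ.le, hl⟩) hBm
      (by rw [rB, rG]; nlinarith)
  have h1 := mul_le_mul_of_nonneg_left hle (mul_pos hβ0 (sub_pos.2 hτ)).le
  have h2 := mul_pos (sub_pos.2 hβ) hB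
  rw [gain]
  linarith

/-- If high-signal agents surely contribute and a low-signal agent does not gain at `x`, she
strictly loses at every larger contribution probability `y` of the low-signal agents. -/
theorem gain_neg_of_lt {n T : ℕ} (hT : 1 ≤ T ∧ T ≤ n) {p τ β x y : ℝ} (hp : 1 / 2 < p ∧ p < 1)
    (hτ : τ < 1) (hβ0 : 0 < β) (hβ : β < τ) (hx : 0 ≤ x) (hxy : x < y) (hy : y ≤ 1)
    (hgain : gain n T p τ β 1 x ≤ 0) : gain n T p τ β 1 y < 0 := by
  obtain ⟨k, rfl⟩ : ∃ k, T = k + 1 := ⟨T - 1, by omega⟩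
  obtain ⟨m, rfl⟩ : ∃ m, n = m + 1 := ⟨n - 1, by omega⟩
  simp only [gain, Nat.add_sub_cancel] at hgain ⊢
  rcases k with _ | k
  · simp only [binTail_zero]
    linarith
  obtain ⟨m, rfl⟩ : ∃ m', m = m' + 1 := ⟨m - 1, by omega⟩
  have hpos : ∀ z, 0 ≤ z → z ≤ 1 → 0 < binTail (m + 1) (k + 1) (rB p 1 z) := fun z hz hz1 ↦
    binTail_pos (by omega) (by rw [rB]; nlinarith) (by rw [rB]; nlinarith)
  have hX := hpos x hx (by linarith)
  have hY := hpos y (by linarith) hy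
  have ha : 0 < β * (1 - τ) := mul_pos hβ0 (sub_pos.2 hτ)
  have h1 := mul_lt_mul_of_pos_left
    (binTail_single_crossing (m := m) (k := k) (by omega) hp.1 hp.2 hx hxy hy) ha
  have h2 := mul_nonneg (neg_nonneg.2 hgain) hY.le
  refine neg_of_mul_neg_left (b := binTail (m + 1) (k + 1) (rB p 1 x)) ?_ hX.le
  linear_combination h1 + h2

/-- In a non-trivial symmetric equilibrium at a moderate price, high-signal agents contribute
with probability one. -/
theorem IsSymmEq.high_eq_one {n T : ℕ} {μ p τ σh σl : ℝ} (h : IsSymmEq n T μ p τ σh σl)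
    (hσ : 0 < σh ∨ 0 < σl) (hμ : 0 < μ ∧ μ < 1) (hp : 1 / 2 < p ∧ p < 1)
    (hmod : postL μ p < τ ∧ τ < postH μ p) (hT : 1 ≤ T ∧ T ≤ n) : σh = 1 := by
  obtain ⟨hh0, hh1, hl0, hl1, -, hH, hL, -⟩ := h
  have hp' : 0 < p ∧ p < 1 := ⟨by linarith, hp.2⟩
  have hβH := postH_lt_one hμ hp'
  have hβL := postL_pos hμ hp'
  rcases le_or_gt σl σh with hle | hlt
  · have hpos : 0 < σh := hσ.elim id fun h ↦ h.trans_le hle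
    by_contra hne
    exact (hH (lt_of_le_of_ne hh1 hne)).not_gt
      (gain_pos hT hp (hβL.trans hmod.1) hmod.2 hβH hpos hh1 hl0 hle)
  · have hpos : 0 < σl := hh0.trans_lt hlt
    exact ((hL hpos).not_gt
      (gain_neg hT hp (hmod.2.trans hβH) hβL hmod.1 hpos hl1 hh0 hlt.le)).elim

/-- AKS Theorem 4: for a moderate price (`β_l < τ < β_h`) there is a
unique symmetric non-trivial Bayes–Nash equilibrium, in which high-signal agents
contribute with probability one and low-signal agents mix with probability in `[0,1)`. -/
theorem moderate_price_equilibrium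
    (n T : ℕ) (μ p τ : ℝ)
    (hμ : 0 < μ ∧ μ < 1) (hp : 1 / 2 < p ∧ p < 1)
    (hmod : postL μ p < τ ∧ τ < postH μ p)
    (hT : 1 ≤ T ∧ T ≤ n) :
    ∃ σ : ℝ × ℝ,
      (IsSymmEq n T μ p τ σ.1 σ.2 ∧ (0 < σ.1 ∨ 0 < σ.2)) ∧
      (∀ σ' : ℝ × ℝ,
        (IsSymmEq n T μ p τ σ'.1 σ'.2 ∧ (0 < σ'.1 ∨ 0 < σ'.2)) → σ' = σ) ∧
      σ.1 = 1 ∧ 0 ≤ σ.2 ∧ σ.2 < 1 := by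
  have hp' : 0 < p ∧ p < 1 := ⟨by linarith, hp.2⟩
  have hβH := postH_lt_one hμ hp'
  have hβL := postL_pos hμ hp'
  have hτ0 : 0 < τ := hβL.trans hmod.1
  have hτ1 : τ < 1 := hmod.2.trans hβH
  set g : ℝ → ℝ := gain n T p τ (postL μ p) 1 with hg
  have hg1 : g 1 < 0 :=
    gain_neg hT hp hτ1 hβL hmod.1 one_pos le_rfl zero_le_one le_rfl
  obtain ⟨x, hx0, hx1, hpos, hneg⟩ :
      ∃ x, 0 ≤ x ∧ x < 1 ∧ (0 < x → 0 ≤ g x) ∧ g x ≤ 0 := by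
    rcases le_or_gt (g 0) 0 with h0 | h0
    · exact ⟨0, le_rfl, one_pos, fun h ↦ (lt_irrefl _ h).elim, h0⟩
    have hcont : Continuous g := by
      have := continuous_binTail (n - 1) (T - 1)
      unfold g gain rG rB
      fun_prop
    obtain ⟨x, hx, hgx⟩ :=
      intermediate_value_Icc' (zero_le_one (α := ℝ)) hcont.continuousOn ⟨hg1.le, h0.le⟩
    refine ⟨x, hx.1, lt_of_le_of_ne hx.2 ?_, fun _ ↦ hgx.ge, hgx.le⟩
    rintro rfl
    exact hg1.ne hgx
  refine ⟨(1, x), ⟨⟨zero_le_one, le_rfl, hx0, hx1.le, fun _ ↦ ?_, fun h ↦ (lt_irrefl _ h).elim,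
    hpos, fun _ ↦ hneg⟩, Or.inl one_pos⟩, ?_, rfl, hx0, hx1⟩
  · exact (gain_pos hT hp hτ0 hmod.2 hβH one_pos le_rfl hx0 hx1.le).le
  rintro ⟨σh, y⟩ ⟨h, hσ⟩
  obtain rfl : σh = 1 := h.high_eq_one hσ hμ hp hmod hT
  obtain ⟨-, -, hy0, hy1, -, -, hypos, hyneg⟩ := h
  refine Prod.ext rfl ?_
  rcases lt_trichotomy y x with hyx | hyx | hxy
  · exact ((hpos (hy0.trans_lt hyx)).not_gt (gain_neg_of_lt hT hp hτ1 hβL hmod.1 hy0 hyx hx1.le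
      (hyneg (hyx.trans hx1)))).elim
  · exact hyx
  · exact ((hypos (hx0.trans_lt hxy)).not_gt
      (gain_neg_of_lt hT hp hτ1 hβL hmod.1 hx0 hxy hy1 hneg)).elim
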